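/- There exists a universal constant c > 0 with the following property. Let k ≥ 1 and m₁,…,m_k ≥ 1 be integers, let φ ∈ 𝒪¹(ℂ̄∖[0,1]), and let z₀ ∈ D(m₁,…,m_k) with Im z₀ ≠ 0; define z_i (0 ≤ i ≤ k) by z_{i+1} = 1/z_i − m_{i+1}, and set ε_j = 0 if j = 0 or m_j = 1, ε_j = 1 if m_j > 1. Then the remainder R := (T^k φ)(z₀) − (p_{k−1} − q_{k−1}z₀)·( φ(z_k) + φ(z_k − 1) + ε_k·φ(z_k + 1) ) + (p_{k−2} − q_{k−2}z₀)·(1 + z_{k−1})·ε_{k−1}·φ( −z_{k−1}/(1 + z_{k−1}) ) satisfies |R| ≤ c·k·((√5 + 1)/2)^{−k}·sup_{D∞} |φ|. -/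

import Mathlib

open Complex Filter Set Topology
open scoped ENNReal NNReal

noncomputable section

/-- The complement in `ℂ` of the real segment `[a, b]`. -/
def cutPlane (a b : ℝ) : Set ℂ := (Complex.ofReal '' Set.Icc a b)ᶜ

/-- `𝒪¹(ℂ̄ ∖ [a,b])`: holomorphic on `ℂ ∖ [a,b]`, vanishing at infinity. -/
def O1 (a b : ℝ) : Set (ℂ → ℂ) :=
  {φ | DifferentiableOn ℂ φ (cutPlane a b) ∧
       Tendsto φ (Bornology.cobounded ℂ) (nhds 0)}

/-- `𝒪³(ℂ̄ ∖ [a,b])`: holomorphic on `ℂ ∖ [a,b]`, with `z²ψ(z) → 0` at infinity. -/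
def O3 (a b : ℝ) : Set (ℂ → ℂ) :=
  {ψ | DifferentiableOn ℂ ψ (cutPlane a b) ∧
       Tendsto (fun z => z ^ 2 * ψ z) (Bornology.cobounded ℂ) (nhds 0)}

/-- The `m`-th term (for the integer `m+1 ≥ 1`) of the series defining `T`. -/
def Tterm (φ : ℂ → ℂ) (m : ℕ) (z : ℂ) : ℂ :=
  -z * (φ (z⁻¹ - ((m : ℂ) + 1)) - φ (-((m : ℂ) + 1))) + deriv φ (-((m : ℂ) + 1))

/-- The operator `T`. -/
def Tbrj (φ : ℂ → ℂ) : ℂ → ℂ := fun z => ∑' m : ℕ, Tterm φ m z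

/-- The operator `T⁽³⁾`. -/
def T3brj (ψ : ℂ → ℂ) : ℂ → ℂ := fun z => -∑' m : ℕ, (z⁻¹) ^ 3 * ψ (z⁻¹ - ((m : ℂ) + 1))

/-- `g(m) = (0 1; 1 m)`. -/
def gmat (m : ℤ) : Matrix (Fin 2) (Fin 2) ℤ := !![0, 1; 1, m]

/-- The monoid `ℳ`. -/
def Mmon : Set (Matrix (Fin 2) (Fin 2) ℤ) :=
  {g | g = 1 ∨
    ((g 0 0 * g 1 1 - g 0 1 * g 1 0 = 1 ∨ g 0 0 * g 1 1 - g 0 1 * g 1 0 = -1) ∧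
      g 0 1 ≤ g 1 1 ∧ g 0 0 ≤ g 0 1 ∧ 0 ≤ g 0 0 ∧ g 1 0 ≤ g 1 1 ∧ g 0 0 ≤ g 1 0)}

/-- The operator `L_g` on `𝒪¹(ℂ̄ ∖ [0,1])`, for `g = (a b; c d) ∈ ℳ`. -/
def Lop (g : Matrix (Fin 2) (Fin 2) ℤ) (φ : ℂ → ℂ) : ℂ → ℂ := fun z =>
  if g = 1 then φ z
  else
    ((g 0 0 : ℂ) - (g 1 0 : ℂ) * z) *
        (φ (((g 1 1 : ℂ) * z - (g 0 1 : ℂ)) / ((g 0 0 : ℂ) - (g 1 0 : ℂ) * z)) -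
          φ (-(g 1 1 : ℂ) / (g 1 0 : ℂ))) -
      ((g 0 0 * g 1 1 - g 0 1 * g 1 0 : ℤ) : ℂ) * ((g 1 0 : ℂ))⁻¹ *
        deriv φ (-(g 1 1 : ℂ) / (g 1 0 : ℂ))

/-- `Σ_ℳ φ`, the sum of the family `(L_g φ)_{g ∈ ℳ}`. -/
def sumM (φ : ℂ → ℂ) : ℂ → ℂ := fun z => ∑' g : Mmon, Lop g.1 φ z

/-- The domain `D`. -/
def Dset : Set ℂ :=
  {z | ‖z‖ ≤ 1 ∧ 1 ≤ ‖z - Complex.I‖ ∧ 1 ≤ ‖z + Complex.I‖ ∧ 0 < z.re}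

/-- The domain `D₀`. -/
def D0set : Set ℂ := {z | ‖z + 1‖ ≤ 1 ∧ Real.sqrt 3 / 2 - 1 ≤ z.re}

/-- The domain `D₁`. -/
def D1set : Set ℂ :=
  {z | 1 ≤ ‖z‖ ∧ ‖z - (1 / Real.sqrt 3 : ℝ)‖ ≤ 1 / Real.sqrt 3}

/-- The domain `H₀`. -/
def H0set : Set ℂ := {z | ‖z - Complex.I‖ ≤ 1 ∧ 1 ≤ ‖z + 1‖ ∧ z.im ≤ 1 / 2}

/-- The domain `H₀′`. -/
def H0set' : Set ℂ := {z | (starRingEnd ℂ) z ∈ H0set}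

/-- The domain `Δ`. -/
def Δset : Set ℂ := {z | ‖z‖ ≤ 1 ∧ 1 ≤ ‖z + 1‖ ∧ |z.im| ≤ 1 / 2}

/-- The domain `D∞`. -/
def Dinf : Set ℂ :=
  {z | 1 / 2 < |z.im|} ∪ {z | z.re < Real.sqrt 3 / 2 - 1} ∪
    {z | Real.sqrt 3 / 2 < z.re ∧ 1 / Real.sqrt 3 < ‖z - (1 / Real.sqrt 3 : ℝ)‖}

end

/-- `pden m n = p_{n-1}` where `p₋₁ = 1, p₀ = 0, p_{i+1} = m_{i+1} p_i + p_{i-1}`. -/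
def pden (m : ℕ → ℤ) : ℕ → ℤ
  | 0 => 1
  | 1 => 0
  | n + 2 => m (n + 1) * pden m (n + 1) + pden m n

/-- `qden m n = q_{n-1}` where `q₋₁ = 0, q₀ = 1, q_{i+1} = m_{i+1} q_i + q_{i-1}`. -/
def qden (m : ℕ → ℤ) : ℕ → ℤ
  | 0 => 0
  | 1 => 1
  | n + 2 => m (n + 1) * qden m (n + 1) + qden m n

/-- A quantitative decay condition on the second derivative in a left half-plane. -/
structure SecondDerivBound (χ : ℂ → ℂ) (B : ℝ) : Prop where
  diff : DifferentiableOn ℂ χ {z | z.re < -1 / 4}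
  bound : ∀ z : ℂ, z.re ≤ -1 / 2 → ‖deriv (deriv χ) z‖ ≤ B / ‖z - 1 / 2‖ ^ 3

/-- Bounds for a function and its first two derivatives in a left half-plane. -/
structure LeftBound (χ : ℂ → ℂ) (A : ℝ) : Prop extends SecondDerivBound χ A where
  norm_le : ∀ z : ℂ, z.re ≤ -1 / 2 → ‖χ z‖ ≤ A
  norm_deriv_le : ∀ n : ℕ, ‖deriv χ (-((n : ℂ) + 1))‖ ≤ A / ((n : ℝ) + 1) ^ 2

/-- The sum of the inverse squares. -/
noncomputable def invSqSum : ℝ := ∑' n : ℕ, 1 / ((n : ℝ) + 1) ^ 2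

theorem hasSum_invSqSum : HasSum (fun n : ℕ => 1 / ((n : ℝ) + 1) ^ 2) invSqSum := by
  have h : Summable (fun n : ℕ => 1 / ((n : ℝ) + 1) ^ 2) := by
    have := (summable_nat_add_iff 1).2 (Real.summable_one_div_nat_pow.2 one_lt_two)
    simpa using this
  exact h.hasSum

theorem one_le_invSqSum : 1 ≤ invSqSum := by
  have := hasSum_invSqSum.summable.le_tsum 0 (fun n _ => by positivity)
  simpa [invSqSum] using this

theorem re_sub_succ (w : ℂ) (m : ℕ) : (w - ((m : ℂ) + 1)).re = w.re - ((m : ℝ) + 1) := by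
  simp

/-- First order Taylor estimate on a convex set. -/
theorem norm_taylor_le {χ : ℂ → ℂ} {S U : Set ℂ} {Q : ℝ} (hU : IsOpen U)
    (hχ : DifferentiableOn ℂ χ U) (hSU : S ⊆ U) (hS : Convex ℝ S)
    (hQ : ∀ w ∈ S, ‖deriv (deriv χ) w‖ ≤ Q) {a b : ℂ} (ha : a ∈ S) (hb : b ∈ S) :
    ‖χ b - χ a - (b - a) * deriv χ a‖ ≤ Q * ‖b - a‖ ^ 2 := by
  have hQ0 : 0 ≤ Q := (norm_nonneg _).trans (hQ a ha)
  have hseg : segment ℝ a b ⊆ S := hS.segment_subset ha hb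
  have h1 : ∀ w ∈ S, ‖deriv χ w - deriv χ a‖ ≤ Q * ‖w - a‖ := fun w hw =>
    hS.norm_image_sub_le_of_norm_hasDerivWithin_le (f' := deriv (deriv χ))
      (fun x hx => ((hχ.deriv hU).differentiableAt
        (hU.mem_nhds (hSU hx))).hasDerivAt.hasDerivWithinAt) hQ ha hw
  have h2 := (convex_segment a b).norm_image_sub_le_of_norm_hasDerivWithin_le
    (f := fun w => χ w - w * deriv χ a) (f' := fun w => deriv χ w - 1 * deriv χ a)
    (C := Q * ‖b - a‖)
    (fun x hx => (((hχ.differentiableAt (hU.mem_nhds (hSU (hseg hx)))).hasDerivAt).sub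
      ((hasDerivAt_id x).mul_const _)).hasDerivWithinAt)
    (fun x hx => by
      rw [one_mul]
      refine (h1 x (hseg hx)).trans ?_
      gcongr
      exact norm_sub_le_of_mem_segment hx)
    (left_mem_segment ℝ a b) (right_mem_segment ℝ a b)
  calc _ = ‖χ b - b * deriv χ a - (χ a - a * deriv χ a)‖ := by ring_nf
    _ ≤ _ := h2
    _ = _ := by ring

theorem inv_re_neg {z : ℂ} (hz : z.re < 0) : (z⁻¹).re < 0 := by
  have : z ≠ 0 := by rintro rfl; simp at hz
  rw [Complex.inv_re]
  exact div_neg_of_neg_of_pos hz (Complex.normSq_pos.2 this)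

theorem ne_zero_of_re_neg {z : ℂ} (hz : z.re < 0) : z ≠ 0 := by
  rintro rfl; simp at hz

namespace SecondDerivBound

variable {χ : ℂ → ℂ} {B : ℝ}

theorem nonneg (h : SecondDerivBound χ B) : 0 ≤ B := by
  have h1 := (norm_nonneg _).trans (h.bound (-1 / 2) (by norm_num))
  have h2 : ‖(-1 / 2 - 1 / 2 : ℂ)‖ = 1 := by norm_num
  rwa [h2, one_pow, div_one] at h1

theorem bound_of_re_le (h : SecondDerivBound χ B) (m : ℕ) {w : ℂ}
    (hw : w.re ≤ -((m : ℝ) + 1)) : ‖deriv (deriv χ) w‖ ≤ B / ((m : ℝ) + 1) ^ 3 := by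
  have hm : (0 : ℝ) ≤ m := m.cast_nonneg
  refine (h.bound w (by linarith)).trans ?_
  have hB := h.nonneg
  have h1 : (m : ℝ) + 1 ≤ ‖w - 1 / 2‖ := by
    have := (neg_le_abs _).trans (Complex.abs_re_le_norm (w - 1 / 2))
    norm_num at this
    linarith
  gcongr

theorem taylor_left (h : SecondDerivBound χ B) (m : ℕ) {a b : ℂ}
    (ha : a.re ≤ -((m : ℝ) + 1)) (hb : b.re ≤ -((m : ℝ) + 1)) :
    ‖χ b - χ a - (b - a) * deriv χ a‖ ≤ B / ((m : ℝ) + 1) ^ 3 * ‖b - a‖ ^ 2 := by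
  have hm : (0 : ℝ) ≤ m := m.cast_nonneg
  refine norm_taylor_le (isOpen_re_lt (-1 / 4)) h.diff (S := {z | z.re ≤ -((m : ℝ) + 1)})
    (fun w hw => ?_) (convex_halfSpace_re_le _) (fun w hw => h.bound_of_re_le m hw) ha hb
  simp only [mem_ofPred_eq] at hw ⊢
  linarith

theorem norm_Tterm_le (h : SecondDerivBound χ B) (m : ℕ) {z : ℂ} (hz : z.re < 0) :
    ‖Tterm χ m z‖ ≤ B / ((m : ℝ) + 1) ^ 3 / ‖z‖ := by
  have hz0 := ne_zero_of_re_neg hz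
  have hu := inv_re_neg hz
  have hT := h.taylor_left m (a := -((m : ℂ) + 1)) (b := z⁻¹ - ((m : ℂ) + 1))
    (by simp) (by rw [re_sub_succ]; linarith)
  have e1 : z⁻¹ - ((m : ℂ) + 1) - -((m : ℂ) + 1) = z⁻¹ := by ring
  rw [e1] at hT
  have e2 : Tterm χ m z = -z * (χ (z⁻¹ - ((m : ℂ) + 1)) - χ (-((m : ℂ) + 1)) -
      z⁻¹ * deriv χ (-((m : ℂ) + 1))) := by
    rw [Tterm]; field_simp; ring
  rw [e2, norm_mul, norm_neg]
  calc _ ≤ ‖z‖ * (B / ((m : ℝ) + 1) ^ 3 * ‖z⁻¹‖ ^ 2) := by gcongr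
    _ = _ := by
      have : ‖z‖ ≠ 0 := norm_ne_zero_iff.2 hz0
      rw [norm_inv]; field_simp

theorem hasDerivAt_Tterm (h : SecondDerivBound χ B) (m : ℕ) {z : ℂ} (hz : z.re < 0) :
    HasDerivAt (Tterm χ m) (-(χ (z⁻¹ - ((m : ℂ) + 1)) - χ (-((m : ℂ) + 1))) +
      z⁻¹ * deriv χ (z⁻¹ - ((m : ℂ) + 1))) z := by
  have hz0 := ne_zero_of_re_neg hz
  have hu := inv_re_neg hz
  have hd : HasDerivAt χ (deriv χ (z⁻¹ - ((m : ℂ) + 1))) (z⁻¹ - ((m : ℂ) + 1)) :=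
    (h.diff.differentiableAt ((isOpen_re_lt _).mem_nhds (by
      have hm : (0 : ℝ) ≤ m := m.cast_nonneg
      rw [mem_ofPred_eq, re_sub_succ]; linarith))).hasDerivAt
  have h1 := (hd.comp z ((hasDerivAt_inv hz0).sub_const ((m : ℂ) + 1)))
  have h2 := (((hasDerivAt_id z).neg.mul (h1.sub_const (χ (-((m : ℂ) + 1))))).add_const
    (deriv χ (-((m : ℂ) + 1))))
  refine HasDerivAt.congr_deriv h2 ?_
  simp only [Function.comp_apply, Pi.neg_apply, id_eq]
  field_simp

theorem hasDerivAt_deriv_Tterm (h : SecondDerivBound χ B) (m : ℕ) {z : ℂ} (hz : z.re < 0) :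
    HasDerivAt (deriv (Tterm χ m)) (-(z⁻¹) ^ 3 * deriv (deriv χ) (z⁻¹ - ((m : ℂ) + 1))) z := by
  have hz0 := ne_zero_of_re_neg hz
  have hu := inv_re_neg hz
  have hmem : z⁻¹ - ((m : ℂ) + 1) ∈ {z : ℂ | z.re < -1 / 4} := by
    have hm : (0 : ℝ) ≤ m := m.cast_nonneg
    rw [mem_ofPred_eq, re_sub_succ]; linarith
  have hd : HasDerivAt χ (deriv χ (z⁻¹ - ((m : ℂ) + 1))) (z⁻¹ - ((m : ℂ) + 1)) :=
    (h.diff.differentiableAt ((isOpen_re_lt _).mem_nhds hmem)).hasDerivAt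
  have hd2 : HasDerivAt (deriv χ) (deriv (deriv χ) (z⁻¹ - ((m : ℂ) + 1)))
      (z⁻¹ - ((m : ℂ) + 1)) :=
    ((h.diff.deriv (isOpen_re_lt _)).differentiableAt
      ((isOpen_re_lt _).mem_nhds hmem)).hasDerivAt
  have hi := (hasDerivAt_inv hz0)
  have h1 := (hd.comp z (hi.sub_const ((m : ℂ) + 1)))
  have h2 := (hd2.comp z (hi.sub_const ((m : ℂ) + 1)))
  have h3 := ((h1.sub_const (χ (-((m : ℂ) + 1)))).neg).add (hi.mul h2)
  have h4 : deriv (Tterm χ m) =ᶠ[𝓝 z] fun z => -(χ (z⁻¹ - ((m : ℂ) + 1)) - χ (-((m : ℂ) + 1))) +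
      z⁻¹ * deriv χ (z⁻¹ - ((m : ℂ) + 1)) := by
    filter_upwards [(isOpen_re_lt 0).mem_nhds hz] with y hy
    exact (h.hasDerivAt_Tterm m hy).deriv
  refine (HasDerivAt.congr_deriv h3 ?_).congr_of_eventuallyEq h4
  simp only [Function.comp_apply]
  field_simp
  ring

theorem norm_deriv_Tterm_le (h : SecondDerivBound χ B) (m : ℕ) {z : ℂ} (hz : z.re < 0) :
    ‖deriv (Tterm χ m) z‖ ≤ B / ((m : ℝ) + 1) ^ 3 / ‖z‖ ^ 2 := by
  have hu := inv_re_neg hz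
  have hT := h.taylor_left m (b := -((m : ℂ) + 1)) (a := z⁻¹ - ((m : ℂ) + 1))
    (by rw [re_sub_succ]; linarith) (by simp)
  have e1 : -((m : ℂ) + 1) - (z⁻¹ - ((m : ℂ) + 1)) = -z⁻¹ := by ring
  rw [e1] at hT
  rw [(h.hasDerivAt_Tterm m hz).deriv]
  calc _ = ‖χ (-((m : ℂ) + 1)) - χ (z⁻¹ - ((m : ℂ) + 1)) -
        -z⁻¹ * deriv χ (z⁻¹ - ((m : ℂ) + 1))‖ := by ring_nf
    _ ≤ _ := hT
    _ = _ := by rw [norm_neg, norm_inv, inv_pow, div_eq_mul_inv _ (‖z‖ ^ 2)]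

theorem div_cube_le (h : SecondDerivBound χ B) (m : ℕ) :
    B / ((m : ℝ) + 1) ^ 3 ≤ B * (1 / ((m : ℝ) + 1) ^ 2) := by
  have hB := h.nonneg
  have hm : (0 : ℝ) ≤ m := m.cast_nonneg
  rw [mul_one_div]
  gcongr
  · linarith
  · norm_num

theorem quarter_lt_norm {z : ℂ} (hz : z.re < -1 / 4) : 1 / 4 < ‖z‖ := by
  have := (neg_le_abs _).trans (Complex.abs_re_le_norm z)
  linarith

theorem norm_Tterm_le_of_re_lt (h : SecondDerivBound χ B) (m : ℕ) {z : ℂ} (hz : z.re < -1 / 4) :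
    ‖Tterm χ m z‖ ≤ 4 * B * (1 / ((m : ℝ) + 1) ^ 2) := by
  have hB := h.nonneg
  have h4 := quarter_lt_norm hz
  calc _ ≤ B / ((m : ℝ) + 1) ^ 3 / ‖z‖ := h.norm_Tterm_le m (by linarith)
    _ ≤ B * (1 / ((m : ℝ) + 1) ^ 2) / (1 / 4) := by gcongr; exact h.div_cube_le m
    _ = _ := by ring

theorem hasDerivAt_Tbrj (h : SecondDerivBound χ B) {z : ℂ} (hz : z.re < -1 / 4) :
    HasSum (fun m => deriv (Tterm χ m) z) (deriv (Tbrj χ) z) :=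
  Complex.hasSum_deriv_of_summable_norm (hasSum_invSqSum.summable.mul_left (4 * B))
    (fun m w hw => (h.hasDerivAt_Tterm m
      (lt_trans hw (by norm_num))).differentiableAt.differentiableWithinAt)
    (isOpen_re_lt (-1 / 4)) (fun m _ hw => h.norm_Tterm_le_of_re_lt m hw) hz

theorem differentiableOn_Tbrj (h : SecondDerivBound χ B) :
    DifferentiableOn ℂ (Tbrj χ) {z | z.re < -1 / 4} :=
  Complex.differentiableOn_tsum_of_summable_norm (hasSum_invSqSum.summable.mul_left (4 * B))
    (fun m w hw => (h.hasDerivAt_Tterm m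
      (lt_trans hw (by norm_num))).differentiableAt.differentiableWithinAt)
    (isOpen_re_lt (-1 / 4)) (fun m _ hw => h.norm_Tterm_le_of_re_lt m hw)

theorem hasSum_deriv_deriv_Tterm (h : SecondDerivBound χ B) {z : ℂ} (hz : z.re < -1 / 4) :
    HasSum (fun m => deriv (deriv (Tterm χ m)) z) (deriv (deriv (Tbrj χ)) z) := by
  have hB := h.nonneg
  have h1 := Complex.hasSum_deriv_of_summable_norm (F := fun m => deriv (Tterm χ m))
    (hasSum_invSqSum.summable.mul_left (16 * B))
    (fun m w hw => (h.hasDerivAt_deriv_Tterm m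
      (lt_trans hw (by norm_num))).differentiableAt.differentiableWithinAt)
    (isOpen_re_lt (-1 / 4)) (fun m w hw => ?_) hz
  · have h2 : deriv (Tbrj χ) =ᶠ[𝓝 z] fun w => ∑' m, deriv (Tterm χ m) w := by
      filter_upwards [(isOpen_re_lt (-1 / 4)).mem_nhds hz] with w hw
      exact (h.hasDerivAt_Tbrj hw).tsum_eq.symm
    rwa [h2.deriv_eq]
  · have h4 := quarter_lt_norm hw
    have hw' : w.re < -1 / 4 := hw
    calc _ ≤ B / ((m : ℝ) + 1) ^ 3 / ‖w‖ ^ 2 := h.norm_deriv_Tterm_le m (by linarith)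
      _ ≤ B * (1 / ((m : ℝ) + 1) ^ 2) / (1 / 4) ^ 2 := by gcongr; exact h.div_cube_le m
      _ = _ := by ring

theorem norm_Tbrj_le (h : SecondDerivBound χ B) {z : ℂ} (hz : z.re < -1 / 4) :
    ‖Tbrj χ z‖ ≤ 4 * B * invSqSum :=
  tsum_of_norm_bounded (hasSum_invSqSum.mul_left (4 * B))
    (fun m => h.norm_Tterm_le_of_re_lt m hz)

theorem norm_deriv_Tbrj_le (h : SecondDerivBound χ B) {z : ℂ} (hz : z.re < -1 / 4) :
    ‖deriv (Tbrj χ) z‖ ≤ B * invSqSum / ‖z‖ ^ 2 := by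
  rw [← (h.hasDerivAt_Tbrj hz).tsum_eq]
  refine tsum_of_norm_bounded ((hasSum_invSqSum.mul_left B).div_const _) (fun m => ?_)
  refine (h.norm_deriv_Tterm_le m (by linarith)).trans ?_
  gcongr
  exact h.div_cube_le m

end SecondDerivBound

theorem mul_norm_sub_half_le {κ a : ℝ} {z : ℂ} (hκ : 0 ≤ κ) (hκa : κ ≤ a) (hz : z.re ≤ -1 / 2)
    (h : κ * (1 / 2 - z.re) ≤ 1 - a * z.re) : κ * ‖z - 1 / 2‖ ≤ ‖1 - (a : ℂ) * z‖ := by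
  refine le_of_sq_le_sq ?_ (norm_nonneg _)
  rw [mul_pow, Complex.sq_norm, Complex.sq_norm, Complex.normSq_apply, Complex.normSq_apply]
  have e1 : (z - 1 / 2).re = z.re - 1 / 2 := by simp
  have e2 : (z - 1 / 2).im = z.im := by simp
  have e3 : (1 - (a : ℂ) * z).re = 1 - a * z.re := by simp
  have e4 : (1 - (a : ℂ) * z).im = -(a * z.im) := by simp
  rw [e1, e2, e3, e4]
  have h1 : (κ * (1 / 2 - z.re)) ^ 2 ≤ (1 - a * z.re) ^ 2 :=
    pow_le_pow_left₀ (mul_nonneg hκ (by linarith)) h 2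
  have h2 : κ ^ 2 * z.im ^ 2 ≤ a ^ 2 * z.im ^ 2 := by gcongr
  nlinarith

theorem hasSum_sub_succ_of_tendsto_zero {s : ℕ → ℝ} (hs : Antitone s)
    (h0 : Tendsto s atTop (𝓝 0)) : HasSum (fun n => s n - s (n + 1)) (s 0) := by
  rw [hasSum_iff_tendsto_nat_of_nonneg (fun n => sub_nonneg.2 (hs n.le_succ))]
  simp_rw [Finset.sum_range_sub']
  simpa using (tendsto_const_nhds (x := s 0)).sub h0

/-- An explicit summable majorant, of total mass less than `3 / 5`, for the operator norm of
`T⁽³⁾` with respect to the weight `‖z - 1 / 2‖⁻³`. -/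
theorem exists_hasSum_le_three_fifths : ∃ (v : ℕ → ℝ) (t : ℝ), HasSum v t ∧ t ≤ 3 / 5 ∧
    ∀ (m : ℕ) (z : ℂ), z.re ≤ -1 / 2 →
      (‖1 - ((m : ℂ) + 3 / 2) * z‖ ^ 3)⁻¹ ≤ v m / ‖z - 1 / 2‖ ^ 3 := by
  let s : ℕ → ℝ := fun m => if m = 0 then 59 / 108 else 4 / ((m : ℝ) + 3) ^ 2
  have hs : Antitone s := by
    refine antitone_nat_of_succ_le fun n => ?_
    rcases n with _ | n
    · norm_num [s]
    · simp only [s, Nat.add_eq_zero_iff, one_ne_zero, and_false, if_false]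
      gcongr
      linarith
  have h0 : Tendsto s atTop (𝓝 0) := by
    have h1 : Tendsto (fun m : ℕ => 4 / ((m : ℝ) + 3) ^ 2) atTop (𝓝 0) :=
      Tendsto.const_div_atTop ((tendsto_pow_atTop two_ne_zero).comp
        (tendsto_atTop_add_const_right _ _ tendsto_natCast_atTop_atTop)) _
    refine h1.congr' ?_
    filter_upwards [eventually_gt_atTop 0] with m hm
    simp [s, hm.ne']
  have key : ∀ (m : ℕ) (z : ℂ) (κ : ℝ), z.re ≤ -1 / 2 → 0 < κ → κ ≤ (m : ℝ) + 3 / 2 →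
      κ * (1 / 2 - z.re) ≤ 1 - ((m : ℝ) + 3 / 2) * z.re → (κ ^ 3)⁻¹ ≤ s m - s (m + 1) →
      (‖1 - ((m : ℂ) + 3 / 2) * z‖ ^ 3)⁻¹ ≤ (s m - s (m + 1)) / ‖z - 1 / 2‖ ^ 3 := by
    intro m z κ hz hκ hκm h hv
    have h1 := mul_norm_sub_half_le hκ.le hκm hz h
    push_cast at h1
    have hpos : 0 < ‖z - 1 / 2‖ := norm_pos_iff.2 fun h0 => by
      have : (z - 1 / 2).re = 0 := by rw [h0]; simp
      norm_num at this
      linarith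
    calc _ ≤ ((κ * ‖z - 1 / 2‖) ^ 3)⁻¹ := by gcongr
      _ = (κ ^ 3)⁻¹ / ‖z - 1 / 2‖ ^ 3 := by rw [mul_pow, mul_inv, ← div_eq_mul_inv]
      _ ≤ _ := by gcongr
  refine ⟨_, _, hasSum_sub_succ_of_tendsto_zero hs h0, by norm_num [s], fun m z hz => ?_⟩
  rcases m with _ | m
  · refine key 0 z (3 / 2) hz (by norm_num) (by norm_num) ?_ ?_
    · norm_num; linarith
    · norm_num [s]
  · have hm : (0 : ℝ) ≤ m := m.cast_nonneg
    refine key (m + 1) z (((m : ℝ) + 9 / 2) / 2) hz (by positivity) ?_ ?_ ?_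
    · push_cast; linarith
    · push_cast; nlinarith
    · simp only [s, Nat.add_eq_zero_iff, one_ne_zero, and_false, if_false]
      push_cast
      have e : 4 / ((m : ℝ) + 1 + 3) ^ 2 - 4 / ((m : ℝ) + 1 + 1 + 3) ^ 2 =
          4 * (2 * m + 9) / (((m : ℝ) + 4) ^ 2 * ((m : ℝ) + 5) ^ 2) := by
        field_simp; ring
      rw [e, inv_le_comm₀ (by positivity) (by positivity), inv_div, div_le_iff₀ (by positivity)]
      have : ((m : ℝ) + 4) * (m + 5) ≤ (m + 9 / 2) ^ 2 := by nlinarith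
      calc _ = (((m : ℝ) + 4) * (m + 5)) ^ 2 := by ring
        _ ≤ ((m + 9 / 2) ^ 2) ^ 2 := by gcongr
        _ = _ := by ring

/-- `T` contracts the weighted bound on the second derivative. -/
theorem SecondDerivBound.Tbrj {χ : ℂ → ℂ} {B : ℝ} (h : SecondDerivBound χ B) :
    SecondDerivBound (Tbrj χ) (3 / 5 * B) := by
  refine ⟨h.differentiableOn_Tbrj, fun z hz => ?_⟩
  obtain ⟨v, t, hv, ht, hvz⟩ := exists_hasSum_le_three_fifths
  have hB := h.nonneg
  rw [← (h.hasSum_deriv_deriv_Tterm (z := z) (by linarith)).tsum_eq]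
  calc _ ≤ B * (t / ‖z - 1 / 2‖ ^ 3) := by
        refine tsum_of_norm_bounded ((hv.div_const _).mul_left B) (fun m => ?_)
        have hz' : z.re < 0 := by linarith
        have hz0 := ne_zero_of_re_neg hz'
        have hu := inv_re_neg hz'
        have hm : (0 : ℝ) ≤ m := m.cast_nonneg
        rw [(h.hasDerivAt_deriv_Tterm m hz').deriv, norm_mul, norm_neg, norm_pow]
        calc _ ≤ ‖z⁻¹‖ ^ 3 * (B / ‖z⁻¹ - ((m : ℂ) + 1) - 1 / 2‖ ^ 3) := by
              gcongr
              exact h.bound _ (by rw [re_sub_succ]; linarith)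
          _ = B * (‖1 - ((m : ℂ) + 3 / 2) * z‖ ^ 3)⁻¹ := by
              have e : 1 - ((m : ℂ) + 3 / 2) * z = z * (z⁻¹ - ((m : ℂ) + 1) - 1 / 2) := by
                field_simp; ring
              rw [e, norm_mul, mul_pow, mul_inv, norm_inv, inv_pow]
              ring
          _ ≤ _ := by gcongr; exact hvz m z hz
    _ ≤ B * (3 / 5 / ‖z - 1 / 2‖ ^ 3) := by gcongr
    _ = _ := by ring

theorem SecondDerivBound.mono {χ : ℂ → ℂ} {B C : ℝ} (h : SecondDerivBound χ B) (hBC : B ≤ C) :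
    SecondDerivBound χ C :=
  ⟨h.diff, fun z hz => (h.bound z hz).trans (by gcongr)⟩

theorem SecondDerivBound.leftBound_Tbrj {χ : ℂ → ℂ} {B : ℝ} (h : SecondDerivBound χ B) :
    LeftBound (_root_.Tbrj χ) (4 * B * invSqSum) := by
  have hB := h.nonneg
  have hK := one_le_invSqSum
  refine ⟨h.Tbrj.mono (by nlinarith), fun z hz => h.norm_Tbrj_le (by linarith), fun n => ?_⟩
  have hn : (0 : ℝ) ≤ n := n.cast_nonneg
  have h1 := h.norm_deriv_Tbrj_le (z := -((n : ℂ) + 1)) (by simp; linarith)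
  have e : ‖-((n : ℂ) + 1)‖ = (n : ℝ) + 1 := by
    rw [norm_neg]; exact_mod_cast Complex.norm_natCast (n + 1)
  rw [e] at h1
  refine h1.trans ?_
  gcongr
  nlinarith

theorem LeftBound.iterate_Tbrj {χ : ℂ → ℂ} {A : ℝ} (h : LeftBound χ A) (j : ℕ) :
    LeftBound (_root_.Tbrj^[j] χ) (20 / 3 * invSqSum * A * (3 / 5) ^ j) := by
  have hA := h.nonneg
  have hK := one_le_invSqSum
  have h2 : ∀ j, SecondDerivBound (_root_.Tbrj^[j] χ) (A * (3 / 5) ^ j) := by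
    intro j
    induction j with
    | zero => simpa using h.toSecondDerivBound
    | succ j ih =>
      rw [Function.iterate_succ_apply']
      convert ih.Tbrj using 1
      ring
  rcases j with _ | j
  · have hle : A ≤ 20 / 3 * invSqSum * A * (3 / 5) ^ 0 := by nlinarith
    exact ⟨h.toSecondDerivBound.mono hle, fun z hz => (h.norm_le z hz).trans hle,
      fun n => (h.norm_deriv_le n).trans (by gcongr)⟩
  · rw [Function.iterate_succ_apply']
    convert (h2 j).leftBound_Tbrj using 1
    ring

theorem hasSum_ite_mem_finset (E : Finset ℕ) (a : ℕ → ℂ) :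
    HasSum (fun n => if n ∈ E then a n else 0) (∑ n ∈ E, a n) := by
  have : HasSum (fun n => if n ∈ E then a n else 0) (∑ b ∈ E, if b ∈ E then a b else 0) :=
    hasSum_sum_of_ne_finset_zero fun n hn => if_neg hn
  rwa [Finset.sum_ite_mem, Finset.inter_self] at this

theorem hasSum_ite_mem_finset_const (E : Finset ℕ) (a : ℝ) :
    HasSum (fun n => if n ∈ E then a else 0) (E.card * a) := by
  have : HasSum (fun n => if n ∈ E then a else 0) (∑ b ∈ E, if b ∈ E then a else 0) :=
    hasSum_sum_of_ne_finset_zero fun n hn => if_neg hn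
  rwa [Finset.sum_ite_mem, Finset.inter_self, Finset.sum_const, nsmul_eq_mul] at this

theorem LeftBound.norm_Tterm_le_of_le {χ : ℂ → ℂ} {A : ℝ} (h : LeftBound χ A) {n : ℕ} {z : ℂ}
    (hz : z ≠ 0) (hn : 2 / ‖z‖ ≤ (n : ℝ) + 1) :
    ‖Tterm χ n z‖ ≤ 4 * A * (1 / ((n : ℝ) + 1) ^ 2) := by
  have hA := h.nonneg
  have hz' : 0 < ‖z‖ := norm_pos_iff.2 hz
  have hn1 : (1 : ℝ) ≤ (n : ℝ) + 1 := by linarith [n.cast_nonneg (α := ℝ)]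
  have hinv : ‖z‖⁻¹ ≤ ((n : ℝ) + 1) / 2 := by
    rw [div_eq_mul_inv] at hn; linarith
  have hre : ∀ w ∈ Metric.closedBall (-((n : ℂ) + 1)) (((n : ℝ) + 1) / 2),
      w.re ≤ -(((n : ℝ) + 1) / 2) := by
    intro w hw
    rw [mem_closedBall_iff_norm] at hw
    have := (Complex.re_le_norm _).trans hw
    norm_num at this
    linarith
  have hT := norm_taylor_le (isOpen_re_lt (-1 / 4)) h.diff
    (S := Metric.closedBall (-((n : ℂ) + 1)) (((n : ℝ) + 1) / 2))
    (Q := 8 * A / ((n : ℝ) + 1) ^ 3)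
    (fun w hw => by
      have := hre w hw
      rw [mem_ofPred_eq]; linarith) (convex_closedBall _ _)
    (fun w hw => by
      have h1 := hre w hw
      refine (h.bound w (by linarith)).trans ?_
      have h2 : ((n : ℝ) + 1) / 2 ≤ ‖w - 1 / 2‖ := by
        have := (neg_le_abs _).trans (Complex.abs_re_le_norm (w - 1 / 2))
        norm_num at this
        linarith
      calc _ ≤ A / (((n : ℝ) + 1) / 2) ^ 3 := by gcongr
        _ = _ := by field_simp; norm_num)
    (a := -((n : ℂ) + 1)) (b := z⁻¹ - ((n : ℂ) + 1))
    (Metric.mem_closedBall_self (by linarith))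
    (by
      rw [mem_closedBall_iff_norm]
      have e1 : z⁻¹ - ((n : ℂ) + 1) - -((n : ℂ) + 1) = z⁻¹ := by ring
      rwa [e1, norm_inv])
  have e1 : z⁻¹ - ((n : ℂ) + 1) - -((n : ℂ) + 1) = z⁻¹ := by ring
  rw [e1] at hT
  have e2 : Tterm χ n z = -z * (χ (z⁻¹ - ((n : ℂ) + 1)) - χ (-((n : ℂ) + 1)) -
      z⁻¹ * deriv χ (-((n : ℂ) + 1))) := by
    rw [Tterm]; field_simp; ring
  rw [e2, norm_mul, norm_neg]
  calc _ ≤ ‖z‖ * (8 * A / ((n : ℝ) + 1) ^ 3 * ‖z⁻¹‖ ^ 2) := by gcongr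
    _ = 8 * A / ((n : ℝ) + 1) ^ 3 * ‖z‖⁻¹ := by rw [norm_inv]; field_simp
    _ ≤ 8 * A / ((n : ℝ) + 1) ^ 3 * (((n : ℝ) + 1) / 2) := by gcongr
    _ = _ := by field_simp; ring

/-- Up to a bounded error, `Tχ(z)` is the sum of the terms of its series at those translates
of `1 / z` at which `χ` is not controlled. -/
theorem LeftBound.norm_Tbrj_sub_sum_le {χ : ℂ → ℂ} {A : ℝ} (h : LeftBound χ A) (E : Finset ℕ)
    {z : ℂ} (hz : z ≠ 0) (hE : E.card * ‖z‖ ≤ 3)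
    (hχ : ∀ n ∉ E, ‖χ (z⁻¹ - ((n : ℂ) + 1))‖ ≤ A) :
    ‖_root_.Tbrj χ z - ∑ n ∈ E, -z * χ (z⁻¹ - ((n : ℂ) + 1))‖ ≤ (5 * invSqSum + 7) * A := by
  have hA := h.nonneg
  have hz' : 0 < ‖z‖ := norm_pos_iff.2 hz
  set N := ⌊2 / ‖z‖⌋₊ with hN
  set e : ℕ → ℂ := fun n => if n ∈ E then -z * χ (z⁻¹ - ((n : ℂ) + 1)) else 0 with he
  have hesum : HasSum e (∑ n ∈ E, -z * χ (z⁻¹ - ((n : ℂ) + 1))) := hasSum_ite_mem_finset _ _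
  have hg := ((hasSum_invSqSum.mul_left (5 * A)).add
    (hasSum_ite_mem_finset_const (Finset.range N) (2 * ‖z‖ * A))).add
    (hasSum_ite_mem_finset_const E (‖z‖ * A))
  have hbound : ∀ n, ‖Tterm χ n z - e n‖ ≤ 5 * A * (1 / ((n : ℝ) + 1) ^ 2) +
      (if n ∈ Finset.range N then 2 * ‖z‖ * A else 0) + (if n ∈ E then ‖z‖ * A else 0) := by
    intro n
    have hsq : 0 ≤ A * (1 / ((n : ℝ) + 1) ^ 2) := by positivity
    have hr : 0 ≤ if n ∈ Finset.range N then 2 * ‖z‖ * A else 0 := by split_ifs <;> positivity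
    have hd : ‖deriv χ (-((n : ℂ) + 1))‖ ≤ A * (1 / ((n : ℝ) + 1) ^ 2) := by
      rw [mul_one_div]; exact h.norm_deriv_le n
    have hv : ‖χ (-((n : ℂ) + 1))‖ ≤ A := h.norm_le _ (by
      simp; linarith [n.cast_nonneg (α := ℝ)])
    by_cases hnE : n ∈ E
    · have e1 : Tterm χ n z - e n = z * χ (-((n : ℂ) + 1)) + deriv χ (-((n : ℂ) + 1)) := by
        simp only [he, hnE, if_true, Tterm]; ring
      rw [e1, if_pos hnE]
      have h1 := norm_add_le (z * χ (-((n : ℂ) + 1))) (deriv χ (-((n : ℂ) + 1)))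
      rw [norm_mul] at h1
      have : ‖z‖ * ‖χ (-((n : ℂ) + 1))‖ ≤ ‖z‖ * A := by gcongr
      linarith
    · have e1 : Tterm χ n z - e n = Tterm χ n z := by simp [he, hnE]
      rw [e1, if_neg hnE, add_zero]
      by_cases hnN : n ∈ Finset.range N
      · rw [if_pos hnN, Tterm]
        have h1 := norm_add_le
          (-z * (χ (z⁻¹ - ((n : ℂ) + 1)) - χ (-((n : ℂ) + 1)))) (deriv χ (-((n : ℂ) + 1)))
        have h2 : ‖χ (z⁻¹ - ((n : ℂ) + 1)) - χ (-((n : ℂ) + 1))‖ ≤ A + A :=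
          (norm_sub_le _ _).trans (add_le_add (hχ n hnE) hv)
        rw [norm_mul, norm_neg] at h1
        have : ‖z‖ * ‖χ (z⁻¹ - ((n : ℂ) + 1)) - χ (-((n : ℂ) + 1))‖ ≤ ‖z‖ * (A + A) := by gcongr
        linarith
      · have h2 : 2 / ‖z‖ ≤ (n : ℝ) + 1 := by
          rw [Finset.mem_range, not_lt] at hnN
          have h3 := Nat.lt_floor_add_one (2 / ‖z‖)
          have h4 : ((N : ℕ) : ℝ) ≤ n := by exact_mod_cast hnN
          linarith
        have := h.norm_Tterm_le_of_le hz h2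
        linarith
  have hsd : HasSum (fun n => Tterm χ n z - e n) (∑' n, (Tterm χ n z - e n)) :=
    (Summable.of_norm_bounded hg.summable hbound).hasSum
  have hT : _root_.Tbrj χ z - ∑ n ∈ E, -z * χ (z⁻¹ - ((n : ℂ) + 1)) =
      ∑' n, (Tterm χ n z - e n) := by
    have h1 := hsd.add hesum
    simp only [sub_add_cancel] at h1
    rw [_root_.Tbrj, h1.tsum_eq, add_sub_cancel_right]
  rw [hT]
  refine (tsum_of_norm_bounded hg hbound).trans ?_
  have hNz : (N : ℝ) * ‖z‖ ≤ 2 := by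
    rw [← le_div_iff₀ hz']
    exact Nat.floor_le (by positivity)
  rw [Finset.card_range]
  nlinarith

theorem mem_Dinf_of_re_le {w : ℂ} (hw : w.re ≤ -1 / 3) : w ∈ Dinf := by
  refine Or.inl (Or.inr ?_)
  have h3 : (4 / 3 : ℝ) < √3 := Real.lt_sqrt_of_sq_lt (by norm_num)
  rw [mem_ofPred_eq]
  linarith

theorem mem_Dinf_of_le_re {w : ℂ} (hw : 3 / 2 ≤ w.re) : w ∈ Dinf := by
  refine Or.inr ⟨?_, ?_⟩
  · have h3 : √3 < 2 := (Real.sqrt_lt' (by norm_num)).2 (by norm_num)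
    linarith
  · have h3 : (4 / 3 : ℝ) < √3 := Real.lt_sqrt_of_sq_lt (by norm_num)
    have h4 : 1 / √3 < 3 / 4 := by
      rw [div_lt_iff₀ (by linarith)]; linarith
    have h5 := Complex.re_le_norm (w - ((1 / √3 : ℝ) : ℂ))
    rw [Complex.sub_re, Complex.ofReal_re] at h5
    linarith

theorem mem_Dinf_of_lt_im {w : ℂ} (hw : 1 / 2 < |w.im|) : w ∈ Dinf := Or.inl (Or.inl hw)

theorem mem_Dinf_of_lt_norm {w : ℂ} (hw : 2 < ‖w‖) : w ∈ Dinf := by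
  by_cases h1 : 1 / 2 < |w.im|
  · exact mem_Dinf_of_lt_im h1
  have h2 := Complex.norm_le_abs_re_add_abs_im w
  rcases le_total 0 w.re with h | h
  · rw [abs_of_nonneg h] at h2
    exact mem_Dinf_of_le_re (by linarith)
  · rw [abs_of_nonpos h] at h2
    exact mem_Dinf_of_re_le (by linarith)

theorem mem_cutPlane_of_re_lt {w : ℂ} (hw : w.re < 0) : w ∈ cutPlane 0 1 := by
  rintro ⟨x, hx, rfl⟩
  exact absurd hw (not_lt.2 (by simpa using hx.1))

theorem mem_cutPlane_of_im_ne {w : ℂ} (hw : w.im ≠ 0) : w ∈ cutPlane 0 1 := by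
  rintro ⟨x, hx, rfl⟩
  simp at hw

theorem mem_cutPlane_of_lt_norm {w : ℂ} (hw : 1 < ‖w‖) : w ∈ cutPlane 0 1 := by
  rintro ⟨x, hx, rfl⟩
  rw [Complex.norm_real, Real.norm_eq_abs, abs_of_nonneg hx.1] at hw
  linarith [hx.2]

theorem closedBall_subset_Dinf_inter_cutPlane {z : ℂ} (hz : z.re ≤ -1 / 2) :
    Metric.closedBall z (‖z‖ / 8) ⊆ Dinf ∩ cutPlane 0 1 := by
  intro w hw
  rw [mem_closedBall_iff_norm] at hw
  have h1 := (Complex.re_le_norm (w - z)).trans hw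
  rw [Complex.sub_re] at h1
  have h2 := (Complex.abs_im_le_norm (w - z)).trans hw
  rw [Complex.sub_im] at h2
  have h3 := abs_sub_abs_le_abs_sub z.im w.im
  rw [abs_sub_comm] at h3
  by_cases ha : w.re ≤ -1 / 3
  · exact ⟨mem_Dinf_of_re_le ha, mem_cutPlane_of_re_lt (by linarith)⟩
  by_cases hb : 1 / 2 < |w.im|
  · exact ⟨mem_Dinf_of_lt_im hb, mem_cutPlane_of_im_ne (by
      intro h0; rw [h0, abs_zero] at hb; linarith)⟩
  exfalso
  have hn : ‖z‖ ^ 2 = z.re ^ 2 + |z.im| ^ 2 := by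
    rw [Complex.sq_norm, Complex.normSq_apply, sq_abs]; ring
  have hx : z.re ^ 2 ≤ (1 / 3 + ‖z‖ / 8) ^ 2 := by
    rw [← neg_sq]
    exact pow_le_pow_left₀ (by linarith) (by linarith) 2
  have hy : |z.im| ^ 2 ≤ (1 / 2 + ‖z‖ / 8) ^ 2 :=
    pow_le_pow_left₀ (abs_nonneg _) (by linarith) 2
  nlinarith

section BoundOnDinf

variable {φ : ℂ → ℂ} {M : ℝ}

theorem nonneg_of_forall_mem_Dinf (hM : ∀ w ∈ Dinf, ‖φ w‖ ≤ M) : 0 ≤ M :=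
  (norm_nonneg _).trans (hM (-1) (mem_Dinf_of_re_le (by norm_num)))

theorem norm_le_div_of_lt_norm (hφ : φ ∈ O1 0 1) (hM : ∀ w ∈ Dinf, ‖φ w‖ ≤ M) {w : ℂ}
    (hw : 2 < ‖w‖) : ‖φ w‖ ≤ 2 * M / ‖w‖ := by
  have hM0 := nonneg_of_forall_mem_Dinf hM
  set f : ℂ → ℂ := Function.update (fun u => φ u⁻¹) 0 0 with hf
  have hne : ∀ u, u ≠ 0 → f u = φ u⁻¹ := fun u hu => Function.update_of_ne hu _ _
  have hf0 : f 0 = 0 := Function.update_self _ _ _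
  have hinv : ∀ u ∈ Metric.ball (0 : ℂ) (1 / 2), u ≠ 0 → 2 < ‖u⁻¹‖ := by
    intro u hu hu0
    rw [mem_ball_zero_iff] at hu
    rw [norm_inv, lt_inv_comm₀ (by norm_num) (norm_pos_iff.2 hu0)]
    linarith
  have hd : DifferentiableOn ℂ f (Metric.ball 0 (1 / 2)) := by
    refine (Complex.differentiableOn_compl_singleton_and_continuousAt_iff
      (Metric.ball_mem_nhds 0 (by norm_num))).1 ⟨?_, ?_⟩
    · refine DifferentiableOn.congr (f := fun u => φ u⁻¹) ?_ (fun u hu => hne u hu.2)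
      refine hφ.1.comp (fun u hu => (differentiableAt_inv hu.2).differentiableWithinAt) ?_
      exact fun u hu => mem_cutPlane_of_lt_norm (by linarith [hinv u hu.1 hu.2])
    · exact continuousAt_update_same.2 (hφ.2.comp tendsto_inv₀_nhdsNE_zero)
  have hmaps : MapsTo f (Metric.ball 0 (1 / 2)) (Metric.closedBall (f 0) M) := by
    intro u hu
    rw [hf0, mem_closedBall_zero_iff]
    by_cases hu0 : u = 0
    · rwa [hu0, hf0, norm_zero]
    · rw [hne u hu0]
      exact hM _ (mem_Dinf_of_lt_norm (hinv u hu hu0))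
  have hw0 : w ≠ 0 := norm_pos_iff.1 (by linarith)
  have h := Complex.dist_le_div_mul_dist_of_mapsTo_ball hd hmaps (z := w⁻¹) (by
    rw [mem_ball_zero_iff, norm_inv, inv_lt_comm₀ (by linarith) (by norm_num)]
    norm_num; exact hw)
  rw [hf0, dist_zero_right, dist_zero_right, hne _ (inv_ne_zero hw0), inv_inv, norm_inv] at h
  calc _ ≤ _ := h
    _ = _ := by ring

theorem norm_le_div_of_mem_Dinf (hφ : φ ∈ O1 0 1) (hM : ∀ w ∈ Dinf, ‖φ w‖ ≤ M) {w : ℂ}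
    (hw : w ∈ Dinf) (hw0 : w ≠ 0) : ‖φ w‖ ≤ 2 * M / ‖w‖ := by
  rcases lt_or_ge 2 ‖w‖ with h | h
  · exact norm_le_div_of_lt_norm hφ hM h
  · have hM0 := nonneg_of_forall_mem_Dinf hM
    rw [le_div_iff₀ (norm_pos_iff.2 hw0)]
    nlinarith [hM w hw, norm_nonneg (φ w), norm_nonneg w]

theorem leftBound_of_forall_mem_Dinf (hφ : φ ∈ O1 0 1) (hM : ∀ w ∈ Dinf, ‖φ w‖ ≤ M) :
    LeftBound φ (2400 * M) := by
  have hM0 := nonneg_of_forall_mem_Dinf hM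
  have hhalf : ∀ z : ℂ, z.re ≤ -1 / 2 → 1 / 2 ≤ ‖z‖ := fun z hz => by
    have := (neg_le_abs _).trans (Complex.abs_re_le_norm z)
    linarith
  have hcont : ∀ z : ℂ, z.re ≤ -1 / 2 → DiffContOnCl ℂ φ (Metric.ball z (‖z‖ / 8)) :=
    fun z hz => (hφ.1.mono fun w hw =>
      (closedBall_subset_Dinf_inter_cutPlane hz hw).2).diffContOnCl_ball subset_rfl
  have hsph : ∀ z : ℂ, z.re ≤ -1 / 2 → ∀ w ∈ Metric.sphere z (‖z‖ / 8),
      ‖φ w‖ ≤ 16 / 7 * M / ‖z‖ := by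
    intro z hz w hw
    have hz0 := hhalf z hz
    have hw' := hw
    rw [mem_sphere_iff_norm] at hw'
    have h1 : 7 / 8 * ‖z‖ ≤ ‖w‖ := by
      have := norm_sub_norm_le z w
      rw [norm_sub_rev] at this
      linarith
    refine (norm_le_div_of_mem_Dinf hφ hM (closedBall_subset_Dinf_inter_cutPlane hz
      (Metric.sphere_subset_closedBall hw)).1 (norm_pos_iff.1 (by linarith))).trans ?_
    calc _ ≤ 2 * M / (7 / 8 * ‖z‖) := by gcongr
      _ = _ := by field_simp; ring
  refine ⟨⟨hφ.1.mono fun w hw => mem_cutPlane_of_re_lt (lt_trans hw (by norm_num)),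
    fun z hz => ?_⟩, fun z hz => ?_, fun n => ?_⟩
  · have hz0 := hhalf z hz
    have h1 := Complex.norm_iteratedDeriv_le_of_forall_mem_sphere_norm_le 2
      (by linarith : 0 < ‖z‖ / 8) (hcont z hz) (hsph z hz)
    rw [iteratedDeriv_succ, iteratedDeriv_one] at h1
    have h2 : ‖z - 1 / 2‖ ≤ 2 * ‖z‖ := by
      refine (norm_sub_le _ _).trans ?_
      norm_num
      linarith
    have h3 : 0 < ‖z - 1 / 2‖ := by
      have := (neg_le_abs _).trans (Complex.abs_re_le_norm (z - 1 / 2))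
      norm_num at this
      linarith
    calc _ ≤ _ := h1
      _ = 2048 / 7 * M / ‖z‖ ^ 3 := by norm_num [Nat.factorial]; field_simp; ring
      _ ≤ 2048 / 7 * M / (‖z - 1 / 2‖ / 2) ^ 3 := by gcongr; linarith
      _ = 16384 / 7 * M / ‖z - 1 / 2‖ ^ 3 := by field_simp; ring
      _ ≤ _ := by gcongr; norm_num
  · exact (hM z (mem_Dinf_of_re_le (by linarith))).trans (by linarith)
  · have hn : (0 : ℝ) ≤ n := n.cast_nonneg
    have hz : (-((n : ℂ) + 1)).re ≤ -1 / 2 := by simp; linarith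
    have hz0 := hhalf _ hz
    have h1 := Complex.norm_deriv_le_of_forall_mem_sphere_norm_le
      (by linarith : 0 < ‖-((n : ℂ) + 1)‖ / 8) (hcont _ hz) (hsph _ hz)
    have e : ‖-((n : ℂ) + 1)‖ = (n : ℝ) + 1 := by
      rw [norm_neg]; exact_mod_cast Complex.norm_natCast (n + 1)
    rw [e] at h1
    calc _ ≤ _ := h1
      _ = 128 / 7 * M / ((n : ℝ) + 1) ^ 2 := by field_simp; ring
      _ ≤ _ := by gcongr; norm_num

end BoundOnDinf

theorem LeftBound.mono {χ : ℂ → ℂ} {A B : ℝ} (h : LeftBound χ A) (hAB : A ≤ B) :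
    LeftBound χ B :=
  ⟨h.toSecondDerivBound.mono hAB, fun z hz => (h.norm_le z hz).trans hAB,
    fun n => (h.norm_deriv_le n).trans (by gcongr)⟩

/-- The constant by which one application of `T` degrades the bounds. -/
noncomputable def stepConst : ℝ := 5 * invSqSum + 7

theorem twelve_le_stepConst : 12 ≤ stepConst := by
  have := one_le_invSqSum
  unfold stepConst
  linarith

theorem LeftBound.leftBound_Tbrj {χ : ℂ → ℂ} {A : ℝ} (h : LeftBound χ A) :
    LeftBound (_root_.Tbrj χ) (stepConst * A) := by
  have hA := h.nonneg
  have hK := one_le_invSqSum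
  refine h.toSecondDerivBound.leftBound_Tbrj.mono ?_
  unfold stepConst
  nlinarith

theorem LeftBound.norm_Tbrj_le {χ : ℂ → ℂ} {A : ℝ} (h : LeftBound χ A) {w : ℂ} (hw : w ≠ 0)
    (hre : (w⁻¹).re ≤ 1 / 2) : ‖_root_.Tbrj χ w‖ ≤ stepConst * A := by
  have := h.norm_Tbrj_sub_sum_le ∅ hw (by simp) fun n _ => h.norm_le _ (by
    have hn : (0 : ℝ) ≤ n := n.cast_nonneg
    rw [re_sub_succ]
    linarith)
  simpa [stepConst] using this

theorem inv_re_nonpos {w : ℂ} (hw : w.re ≤ 0) : (w⁻¹).re ≤ 0 := by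
  rw [Complex.inv_re]
  exact div_nonpos_of_nonpos_of_nonneg hw (Complex.normSq_nonneg w)

theorem inv_re_le_inv {w : ℂ} {r : ℝ} (hr : 0 < r) (hw : r ≤ w.re) : (w⁻¹).re ≤ r⁻¹ := by
  refine (Complex.re_le_norm _).trans ?_
  rw [norm_inv]
  exact inv_anti₀ hr (hw.trans (Complex.re_le_norm w))

theorem inv_im_ne_zero {w : ℂ} (hw : w.im ≠ 0) : (w⁻¹).im ≠ 0 := by
  have hw0 : w ≠ 0 := fun h => hw (by simp [h])
  rw [Complex.inv_im]
  exact div_ne_zero (neg_ne_zero.2 hw) (Complex.normSq_pos.2 hw0).ne'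

theorem ne_zero_of_im_ne {w : ℂ} (hw : w.im ≠ 0) : w ≠ 0 := fun h => hw (by simp [h])

theorem im_sub_succ (w : ℂ) (m : ℕ) : (w - ((m : ℂ) + 1)).im = w.im := by
  simp

theorem LeftBound.norm_Tbrj_Tbrj_le {χ : ℂ → ℂ} {A : ℝ} (h : LeftBound χ A) {w : ℂ}
    (hw : w.im ≠ 0) (hre : (w⁻¹).re ≤ 1) :
    ‖_root_.Tbrj (_root_.Tbrj χ) w‖ ≤ stepConst * (stepConst * A) := by
  have := h.leftBound_Tbrj.norm_Tbrj_sub_sum_le ∅ (ne_zero_of_im_ne hw) (by simp) fun n _ => by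
    have hn : (0 : ℝ) ≤ n := n.cast_nonneg
    refine h.norm_Tbrj_le (ne_zero_of_im_ne ?_) ((inv_re_nonpos ?_).trans (by norm_num))
    · rw [im_sub_succ]
      exact inv_im_ne_zero hw
    · rw [re_sub_succ]
      linarith
  simpa [stepConst] using this

theorem LeftBound.norm_Tbrj_add_mul_le {χ : ℂ → ℂ} {A : ℝ} (h : LeftBound χ A) {w : ℂ}
    (hw : w ≠ 0) (hw3 : ‖w‖ ≤ 3) (hre : (w⁻¹).re ≤ 1) :
    ‖_root_.Tbrj χ w + w * χ (w⁻¹ - 1)‖ ≤ stepConst * A := by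
  have := h.norm_Tbrj_sub_sum_le {0} hw (by simpa using hw3) fun n hn => h.norm_le _ (by
    have hn1 : (1 : ℝ) ≤ n := by
      exact_mod_cast Nat.one_le_iff_ne_zero.2 (by simpa using hn)
    rw [re_sub_succ]
    linarith)
  simpa [stepConst] using this

section Step

variable {χ : ℂ → ℂ} {A : ℝ} {z w : ℂ} {a : ℕ}

theorem sub_succ_eq (hw : w = z⁻¹ - ((a : ℂ) + 1)) (n : ℕ) :
    z⁻¹ - ((n : ℂ) + 1) = w + a - n := by
  rw [hw]; ring

theorem LeftBound.norm_Tbrj_Tbrj_Tbrj_add_le (h : LeftBound χ A) (hz : z.im ≠ 0)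
    (hz1 : ‖z‖ ≤ 1) (hw : w = z⁻¹ - ((a : ℂ) + 1)) (hw1 : ‖w‖ ≤ 1) (hw0 : 0 < w.re) :
    ‖_root_.Tbrj (_root_.Tbrj (_root_.Tbrj χ)) z + z * _root_.Tbrj (_root_.Tbrj χ) w‖ ≤
      stepConst ^ 3 * A := by
  have hwr := (Complex.re_le_norm w).trans hw1
  have hwi : w.im ≠ 0 := by rw [hw, im_sub_succ]; exact inv_im_ne_zero hz
  have := h.leftBound_Tbrj.leftBound_Tbrj.norm_Tbrj_sub_sum_le {a} (ne_zero_of_im_ne hz)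
    (by simp; linarith) fun n hn => by
      have hi : (w + a - n).im ≠ 0 := by simpa using hwi
      rw [sub_succ_eq hw]
      rcases lt_or_gt_of_ne (show n ≠ a by simpa using hn) with hlt | hgt
      · have hc : (n : ℝ) + 1 ≤ a := by exact_mod_cast hlt
        refine h.norm_Tbrj_Tbrj_le hi ((inv_re_le_inv one_pos ?_).trans (by norm_num))
        simp; linarith
      · have hc : (a : ℝ) + 1 ≤ n := by exact_mod_cast hgt
        refine h.leftBound_Tbrj.norm_Tbrj_le (ne_zero_of_im_ne hi)
          ((inv_re_nonpos ?_).trans (by norm_num))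
        simp; linarith
  rw [Finset.sum_singleton, ← hw] at this
  convert this using 1
  · congr 1; ring
  · rw [← stepConst]; ring

theorem LeftBound.norm_Tbrj_Tbrj_add_le (h : LeftBound χ A) (hz : z.im ≠ 0)
    (hz1 : ‖z‖ ≤ 1) (hw : w = z⁻¹ - ((a : ℂ) + 1)) (hw1 : ‖w‖ ≤ 1) (hw0 : 0 < w.re) :
    ‖_root_.Tbrj (_root_.Tbrj χ) z + z * (_root_.Tbrj χ w -
      (if a = 0 then (0 : ℂ) else 1) * ((1 + w) * χ (-w / (1 + w))))‖ ≤
      2 * stepConst ^ 2 * A := by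
  have hA := h.nonneg
  have hK := twelve_le_stepConst
  have hwr := (Complex.re_le_norm w).trans hw1
  have hwi : w.im ≠ 0 := by rw [hw, im_sub_succ]; exact inv_im_ne_zero hz
  have hi : ∀ n : ℕ, (w + a - n).im ≠ 0 := fun n => by simpa using hwi
  have hgt : ∀ n : ℕ, a < n → ‖_root_.Tbrj χ (w + a - n)‖ ≤ stepConst * A := fun n hn => by
    have hc : (a : ℝ) + 1 ≤ n := by exact_mod_cast hn
    refine h.norm_Tbrj_le (ne_zero_of_im_ne (hi n)) ((inv_re_nonpos ?_).trans (by norm_num))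
    simp; linarith
  rcases a with _ | b
  · have := h.leftBound_Tbrj.norm_Tbrj_sub_sum_le {0} (ne_zero_of_im_ne hz)
      (by simp; linarith) fun n hn => by
        rw [sub_succ_eq hw]
        exact hgt n (Nat.pos_of_ne_zero (by simpa using hn))
    rw [Finset.sum_singleton, ← hw, ← stepConst] at this
    rw [if_pos rfl, zero_mul, sub_zero]
    calc _ = _ := by congr 1; ring
      _ ≤ _ := this
      _ ≤ _ := by nlinarith [mul_nonneg (sq_nonneg stepConst) hA]
  · have := h.leftBound_Tbrj.norm_Tbrj_sub_sum_le {b + 1, b} (ne_zero_of_im_ne hz)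
      (by rw [Finset.card_pair (by omega)]; push_cast; linarith) fun n hn => by
        rw [sub_succ_eq hw]
        simp only [Finset.mem_insert, Finset.mem_singleton, not_or] at hn
        by_cases hnb : b + 1 < n
        · exact hgt n hnb
        · have hc : (n : ℝ) + 1 ≤ b := by exact_mod_cast (by omega : n + 1 ≤ b)
          refine h.norm_Tbrj_le (ne_zero_of_im_ne (hi n))
            ((inv_re_le_inv two_pos ?_).trans (by norm_num))
          simp; linarith
    have e : w + ((b + 1 : ℕ) : ℂ) - b = 1 + w := by push_cast; ring
    rw [Finset.sum_pair (by omega), ← hw, sub_succ_eq hw b, e, ← stepConst] at this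
    have hw' : (1 + w).im ≠ 0 := by simpa using hwi
    have h1 := h.norm_Tbrj_add_mul_le (ne_zero_of_im_ne hw')
      ((norm_add_le _ _).trans (by rw [norm_one]; linarith))
      ((inv_re_le_inv one_pos (by simp; linarith)).trans (by norm_num))
    have e2 : (1 + w)⁻¹ - 1 = -w / (1 + w) := by
      have := ne_zero_of_im_ne hw'
      field_simp; ring
    rw [e2] at h1
    rw [if_neg (by omega), one_mul]
    calc _ = ‖(_root_.Tbrj (_root_.Tbrj χ) z -
          (-z * _root_.Tbrj χ w + -z * _root_.Tbrj χ (1 + w))) -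
          z * (_root_.Tbrj χ (1 + w) + (1 + w) * χ (-w / (1 + w)))‖ := by congr 1; ring
      _ ≤ stepConst * (stepConst * A) + 1 * (stepConst * A) := by
          refine (norm_sub_le _ _).trans (add_le_add this ?_)
          rw [norm_mul]
          gcongr
      _ ≤ _ := by nlinarith [mul_nonneg (by linarith : 0 ≤ stepConst) hA]

theorem re_of_mem_Δset (hw : w ∈ Δset) : -1 / 2 ≤ w.re ∧ w.re ≤ 1 := by
  obtain ⟨h1, h2, h3⟩ := hw
  have hr := (abs_le.1 ((Complex.abs_re_le_norm w).trans h1))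
  refine ⟨?_, hr.2⟩
  have h4 : 1 ≤ ‖w + 1‖ ^ 2 := by nlinarith
  rw [Complex.sq_norm, Complex.normSq_apply] at h4
  simp only [Complex.add_re, Complex.one_re, Complex.add_im, Complex.one_im, add_zero] at h4
  have h5 : w.im * w.im ≤ 1 / 4 := by
    rw [← abs_mul_abs_self]; nlinarith [abs_nonneg w.im]
  nlinarith

theorem LeftBound.norm_Tbrj_add_le (h : LeftBound χ A) (hA : ∀ u ∈ Dinf, ‖χ u‖ ≤ A)
    (hz : z ≠ 0) (hz1 : ‖z‖ ≤ 1) (hw : w = z⁻¹ - ((a : ℂ) + 1)) (hwΔ : w ∈ Δset) :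
    ‖_root_.Tbrj χ z + z * (χ w + χ (w - 1) +
      (if a = 0 then (0 : ℂ) else 1) * χ (w + 1))‖ ≤ stepConst * A := by
  obtain ⟨hw0, hw1⟩ := re_of_mem_Δset hwΔ
  have hgt : ∀ n : ℕ, a + 1 < n → ‖χ (w + a - n)‖ ≤ A := fun n hn => by
    have hc : (a : ℝ) + 2 ≤ n := by exact_mod_cast hn
    refine hA _ (mem_Dinf_of_re_le ?_)
    simp; linarith
  rcases a with _ | b
  · have := h.norm_Tbrj_sub_sum_le {0, 1} hz
      (by rw [Finset.card_pair (by omega)]; push_cast; linarith) fun n hn => by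
        simp only [Finset.mem_insert, Finset.mem_singleton, not_or] at hn
        rw [sub_succ_eq hw]
        exact hgt n (by omega)
    have e : w + ((0 : ℕ) : ℂ) - (1 : ℕ) = w - 1 := by push_cast; ring
    rw [Finset.sum_pair (by omega), ← hw, sub_succ_eq hw 1, e, ← stepConst] at this
    rw [if_pos rfl]
    convert this using 2
    ring
  · have := h.norm_Tbrj_sub_sum_le {b + 1, b + 2, b} hz
      (by
        rw [Finset.card_insert_of_notMem (by simp), Finset.card_pair (by omega)]
        push_cast; linarith) fun n hn => by
        simp only [Finset.mem_insert, Finset.mem_singleton, not_or] at hn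
        rw [sub_succ_eq hw]
        by_cases hnb : b + 2 < n
        · exact hgt n hnb
        · have hc : (n : ℝ) + 1 ≤ b := by exact_mod_cast (by omega : n + 1 ≤ b)
          refine hA _ (mem_Dinf_of_le_re ?_)
          simp; linarith
    have e : w + ((b + 1 : ℕ) : ℂ) - b = w + 1 := by push_cast; ring
    have e' : w + ((b + 1 : ℕ) : ℂ) - (b + 2 : ℕ) = w - 1 := by push_cast; ring
    rw [Finset.sum_insert (by simp), Finset.sum_pair (by omega), ← hw, sub_succ_eq hw b,
      sub_succ_eq hw (b + 2), e, e', ← stepConst] at this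
    rw [if_neg (by omega)]
    convert this using 2
    ring

end Step

section ContinuedFraction

variable {m : ℕ → ℤ} {z : ℕ → ℂ} {k : ℕ}

/-- `p_{l-1} - q_{l-1} z₀`. -/
noncomputable def convergentGap (m : ℕ → ℤ) (z₀ : ℂ) (l : ℕ) : ℂ :=
  (pden m l : ℂ) - (qden m l : ℂ) * z₀

theorem convergentGap_zero (m : ℕ → ℤ) (z₀ : ℂ) : convergentGap m z₀ 0 = 1 := by
  simp [convergentGap, pden, qden]

theorem convergentGap_succ (hne : ∀ i < k, z i ≠ 0)
    (hrec : ∀ i < k, z (i + 1) = (z i)⁻¹ - (m (i + 1) : ℂ)) {l : ℕ} (hl : l < k) :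
    convergentGap m (z 0) (l + 1) = -z l * convergentGap m (z 0) l := by
  induction l with
  | zero => simp [convergentGap, pden, qden]
  | succ l ih =>
    have ih := ih (by omega)
    have h0 := hne l (by omega)
    have h1 : convergentGap m (z 0) (l + 2) =
        m (l + 1) * convergentGap m (z 0) (l + 1) + convergentGap m (z 0) l := by
      simp only [convergentGap, pden, qden]
      push_cast
      ring
    rw [h1, hrec l (by omega), ih]
    field_simp
    ring

theorem convergentGap_mul (hne : ∀ i < k, z i ≠ 0)
    (hrec : ∀ i < k, z (i + 1) = (z i)⁻¹ - (m (i + 1) : ℂ)) {l : ℕ} (hl : l ≤ k) :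
    convergentGap m (z 0) l * ((qden m (l + 1) : ℂ) + (qden m l : ℂ) * z l) = (-1) ^ l := by
  induction l with
  | zero => simp [convergentGap, pden, qden]
  | succ l ih =>
    have h0 := hne l (by omega)
    rw [pow_succ, ← ih (by omega), convergentGap_succ hne hrec (by omega), hrec l (by omega)]
    simp only [qden]
    push_cast
    field_simp
    ring

theorem qden_nonneg (hm : ∀ j, 1 ≤ m j) (l : ℕ) : 0 ≤ qden m l ∧ 0 < qden m (l + 1) := by
  induction l with
  | zero => simp [qden]
  | succ l ih =>
    refine ⟨ih.2.le, ?_⟩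
    have := hm (l + 1)
    simp only [qden]
    nlinarith

theorem pow_le_mul_qden (hm : ∀ j, 1 ≤ m j) {G : ℝ} (hG : 1 ≤ G) (hG2 : G ^ 2 = G + 1) (l : ℕ) :
    G ^ l ≤ G * qden m (l + 1) ∧ G ^ (l + 1) ≤ G * qden m (l + 2) := by
  induction l with
  | zero =>
    have h : (1 : ℝ) ≤ m 1 := by exact_mod_cast hm 1
    simp only [qden]
    norm_num
    exact ⟨hG, by nlinarith⟩
  | succ l ih =>
    refine ⟨ih.2, ?_⟩
    have h : (1 : ℝ) ≤ m (l + 2) := by exact_mod_cast hm (l + 2)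
    have hq : (0 : ℝ) ≤ qden m (l + 2) := by exact_mod_cast (qden_nonneg hm (l + 1)).2.le
    have e : qden m (l + 1 + 2) = m (l + 2) * qden m (l + 2) + qden m (l + 1) := rfl
    rw [e]
    push_cast
    calc G ^ (l + 1 + 1) = G ^ (l + 1) + G ^ l := by
          rw [pow_succ, pow_succ]
          linear_combination G ^ l * hG2
      _ ≤ G * qden m (l + 2) + G * qden m (l + 1) := add_le_add ih.2 ih.1
      _ ≤ G * (m (l + 2) * qden m (l + 2) + qden m (l + 1)) := by
        rw [← mul_add]
        gcongr
        nlinarith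

theorem norm_convergentGap_le (hm : ∀ j, 1 ≤ m j) {G : ℝ} (hG : 1 ≤ G) (hG2 : G ^ 2 = G + 1)
    (hne : ∀ i < k, z i ≠ 0) (hrec : ∀ i < k, z (i + 1) = (z i)⁻¹ - (m (i + 1) : ℂ)) {l : ℕ}
    (hl : l ≤ k) (hre : 0 ≤ (z l).re) : ‖convergentGap m (z 0) l‖ ≤ G * G⁻¹ ^ l := by
  have hq : (0 : ℝ) ≤ qden m l := by exact_mod_cast (qden_nonneg hm l).1
  have hq1 : (0 : ℝ) < qden m (l + 1) := by exact_mod_cast (qden_nonneg hm l).2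
  have h1 := congrArg norm (convergentGap_mul hne hrec hl)
  rw [norm_mul, norm_pow, norm_neg, norm_one, one_pow] at h1
  have h2 : (qden m (l + 1) : ℝ) ≤ ‖(qden m (l + 1) : ℂ) + (qden m l : ℂ) * z l‖ := by
    refine le_trans ?_ (Complex.re_le_norm _)
    simp
    positivity
  have h3 : ‖convergentGap m (z 0) l‖ * qden m (l + 1) ≤ 1 :=
    (mul_le_mul_of_nonneg_left h2 (norm_nonneg _)).trans h1.le
  have h4 := (pow_le_mul_qden hm hG hG2 l).1
  rw [inv_pow, ← div_eq_mul_inv, le_div_iff₀ (by positivity)]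
  calc _ ≤ ‖convergentGap m (z 0) l‖ * (G * qden m (l + 1)) := by gcongr
    _ = G * (‖convergentGap m (z 0) l‖ * qden m (l + 1)) := by ring
    _ ≤ G * 1 := by gcongr
    _ = G := mul_one G

end ContinuedFraction

section Approximation

variable {m : ℕ → ℤ} {z : ℕ → ℂ} {k : ℕ} {φ : ℂ → ℂ} {A G : ℝ}

theorem im_ne_zero_of_rec (hrec : ∀ i < k, z (i + 1) = (z i)⁻¹ - (m (i + 1) : ℂ))
    (him : (z 0).im ≠ 0) {i : ℕ} (hi : i ≤ k) : (z i).im ≠ 0 := by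
  induction i with
  | zero => exact him
  | succ i ih =>
    rw [hrec i (by omega), Complex.sub_im, Complex.intCast_im, sub_zero]
    exact inv_im_ne_zero (ih (by omega))

theorem exists_eq_natCast_add_one (hm : ∀ j, 1 ≤ m j) (j : ℕ) : ∃ a : ℕ, m j = a + 1 :=
  ⟨(m j - 1).toNat, by have := hm j; omega⟩

theorem norm_iterate_Tbrj_sub_le (hm : ∀ j, 1 ≤ m j) (hG : 1 ≤ G) (hG' : G ≤ 2)
    (hG2 : G ^ 2 = G + 1) (hL : ∀ j, LeftBound (Tbrj^[j] φ) (A * G⁻¹ ^ j))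
    (hD : ∀ i < k, z i ∈ Dset) (hrec : ∀ i < k, z (i + 1) = (z i)⁻¹ - (m (i + 1) : ℂ))
    (him : (z 0).im ≠ 0) (l : ℕ) : ∀ i, l + i + 2 = k →
    ‖Tbrj^[k] φ (z 0) - convergentGap m (z 0) l * Tbrj^[i + 2] φ (z l)‖ ≤
      l * (16 * stepConst ^ 3 * A * G⁻¹ ^ k) := by
  have hK := twelve_le_stepConst
  have hA : 0 ≤ A := by simpa using (hL 0).nonneg
  have hne : ∀ i < k, z i ≠ 0 := fun i hi =>
    ne_zero_of_im_ne (im_ne_zero_of_rec hrec him hi.le)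
  induction l with
  | zero =>
    intro i hi
    obtain rfl : i + 2 = k := by omega
    simp [convergentGap_zero]
  | succ l ih =>
    intro i hi
    have ih := ih (i + 1) (by omega)
    obtain ⟨a, ha⟩ := exists_eq_natCast_add_one hm (l + 1)
    have hstep := (hL i).norm_Tbrj_Tbrj_Tbrj_add_le (a := a)
      (im_ne_zero_of_rec hrec him (by omega : l ≤ k)) (hD l (by omega)).1
      (w := z (l + 1)) (by rw [hrec l (by omega), ha]; push_cast; rfl)
      (hD (l + 1) (by omega)).1 (hD (l + 1) (by omega)).2.2.2
    simp only [Function.iterate_succ_apply'] at ih ⊢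
    have hβ := norm_convergentGap_le hm hG hG2 hne hrec (by omega : l ≤ k)
      (hD l (by omega)).2.2.2.le
    have hG3 : G ^ 3 ≤ 8 := by nlinarith
    rw [convergentGap_succ hne hrec (by omega)]
    have hk : G⁻¹ ^ l * G⁻¹ ^ i = G ^ 3 * G⁻¹ ^ k := by
      have hG0 : G ≠ 0 := by positivity
      rw [← hi]
      simp only [inv_pow]
      field_simp
      ring
    refine (norm_sub_le_norm_sub_add_norm_sub _
      (convergentGap m (z 0) l * Tbrj (Tbrj (Tbrj (Tbrj^[i] φ))) (z l)) _).trans ?_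
    push_cast
    rw [add_mul]
    refine add_le_add ih ?_
    calc _ = ‖convergentGap m (z 0) l‖ * ‖Tbrj (Tbrj (Tbrj (Tbrj^[i] φ))) (z l) +
          z l * Tbrj (Tbrj (Tbrj^[i] φ)) (z (l + 1))‖ := by rw [← norm_mul]; congr 1; ring
      _ ≤ (G * G⁻¹ ^ l) * (stepConst ^ 3 * (A * G⁻¹ ^ i)) := by gcongr
      _ = (G * G ^ 3) * (stepConst ^ 3 * A * G⁻¹ ^ k) := by
        linear_combination (G * stepConst ^ 3 * A) * hk
      _ ≤ (2 * 8) * (stepConst ^ 3 * A * G⁻¹ ^ k) := by gcongr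
      _ = _ := by ring

theorem norm_convergentGap_mul_Tbrj_add_le (hm : ∀ j, 1 ≤ m j) (hG : 1 ≤ G) (hG' : G ≤ 2)
    (hG2 : G ^ 2 = G + 1) (hL : LeftBound φ A) (hφ : ∀ w ∈ Dinf, ‖φ w‖ ≤ A)
    (hD : ∀ i < k + 1, z i ∈ Dset)
    (hrec : ∀ i < k + 1, z (i + 1) = (z i)⁻¹ - (m (i + 1) : ℂ))
    (hΔ : z (k + 1) ∈ Δset) (him : (z 0).im ≠ 0) :
    ‖convergentGap m (z 0) k * Tbrj φ (z k) - convergentGap m (z 0) (k + 1) *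
      (φ (z (k + 1)) + φ (z (k + 1) - 1) +
        (if m (k + 1) = 1 then (0 : ℂ) else 1) * φ (z (k + 1) + 1))‖ ≤
      4 * stepConst * A * G⁻¹ ^ (k + 1) := by
  have hK := twelve_le_stepConst
  have hA := hL.nonneg
  have hne : ∀ i < k + 1, z i ≠ 0 := fun i hi =>
    ne_zero_of_im_ne (im_ne_zero_of_rec hrec him hi.le)
  obtain ⟨a, ha⟩ := exists_eq_natCast_add_one hm (k + 1)
  have hstep := hL.norm_Tbrj_add_le (a := a) hφ (hne k (by omega)) (hD k (by omega)).1
    (w := z (k + 1)) (by rw [hrec k (by omega), ha]; push_cast; rfl) hΔ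
  have hif : m (k + 1) = 1 ↔ a = 0 := by omega
  have hβ := norm_convergentGap_le hm hG hG2 hne hrec (by omega : k ≤ k + 1)
    (hD k (by omega)).2.2.2.le
  rw [convergentGap_succ hne hrec (by omega)]
  simp only [hif]
  calc _ = ‖convergentGap m (z 0) k‖ * ‖Tbrj φ (z k) + z k * (φ (z (k + 1)) +
        φ (z (k + 1) - 1) + (if a = 0 then (0 : ℂ) else 1) * φ (z (k + 1) + 1))‖ := by
        rw [← norm_mul]; congr 1; ring
    _ ≤ (G * G⁻¹ ^ k) * (stepConst * A) := by gcongr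
    _ = (G * G) * (stepConst * A * G⁻¹ ^ (k + 1)) := by
      have hG0 : G ≠ 0 := by positivity
      simp only [inv_pow]
      field_simp
      ring
    _ ≤ (2 * 2) * (stepConst * A * G⁻¹ ^ (k + 1)) := by gcongr
    _ = _ := by ring

theorem norm_convergentGap_mul_Tbrj_Tbrj_add_le (hm : ∀ j, 1 ≤ m j) (hG : 1 ≤ G) (hG' : G ≤ 2)
    (hG2 : G ^ 2 = G + 1) (hL : LeftBound φ A) (hD : ∀ i < k + 2, z i ∈ Dset)
    (hrec : ∀ i < k + 2, z (i + 1) = (z i)⁻¹ - (m (i + 1) : ℂ)) (him : (z 0).im ≠ 0) :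
    ‖convergentGap m (z 0) k * Tbrj (Tbrj φ) (z k) -
      (convergentGap m (z 0) (k + 1) * Tbrj φ (z (k + 1)) -
        convergentGap m (z 0) (k + 1) * (1 + z (k + 1)) *
          (if m (k + 1) = 1 then (0 : ℂ) else 1) * φ (-z (k + 1) / (1 + z (k + 1))))‖ ≤
      16 * stepConst ^ 2 * A * G⁻¹ ^ (k + 2) := by
  have hK := twelve_le_stepConst
  have hA := hL.nonneg
  have hne : ∀ i < k + 2, z i ≠ 0 := fun i hi =>
    ne_zero_of_im_ne (im_ne_zero_of_rec hrec him hi.le)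
  obtain ⟨a, ha⟩ := exists_eq_natCast_add_one hm (k + 1)
  have hstep := hL.norm_Tbrj_Tbrj_add_le (a := a)
    (im_ne_zero_of_rec hrec him (by omega : k ≤ k + 2)) (hD k (by omega)).1
    (w := z (k + 1)) (by rw [hrec k (by omega), ha]; push_cast; rfl)
    (hD (k + 1) (by omega)).1 (hD (k + 1) (by omega)).2.2.2
  have hif : m (k + 1) = 1 ↔ a = 0 := by omega
  have hβ := norm_convergentGap_le hm hG hG2 hne hrec (by omega : k ≤ k + 2)
    (hD k (by omega)).2.2.2.le
  rw [convergentGap_succ hne hrec (by omega)]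
  simp only [hif]
  calc _ = ‖convergentGap m (z 0) k‖ * ‖Tbrj (Tbrj φ) (z k) + z k * (Tbrj φ (z (k + 1)) -
        (if a = 0 then (0 : ℂ) else 1) *
          ((1 + z (k + 1)) * φ (-z (k + 1) / (1 + z (k + 1)))))‖ := by
        rw [← norm_mul]; congr 1; ring
    _ ≤ (G * G⁻¹ ^ k) * (2 * stepConst ^ 2 * A) := by gcongr
    _ = (G * G ^ 2) * (2 * stepConst ^ 2 * A * G⁻¹ ^ (k + 2)) := by
      have hG0 : G ≠ 0 := by positivity
      simp only [inv_pow]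
      field_simp
      ring
    _ ≤ (2 * 2 ^ 2) * (2 * stepConst ^ 2 * A * G⁻¹ ^ (k + 2)) := by gcongr
    _ = _ := by ring

end Approximation

/-- the approximation of `T^k φ` on `D(m₁,…,m_k)` (Proposition 4.4). -/
theorem Tk_approximation_on_Dm :
    ∃ c > 0, ∀ (k : ℕ), 1 ≤ k → ∀ (m : ℕ → ℤ), (∀ j, 1 ≤ m j) →
      ∀ φ ∈ O1 0 1, ∀ z : ℕ → ℂ,
        (∀ i < k, z i ∈ Dset) →
        (∀ i < k, z (i + 1) = (z i)⁻¹ - (m (i + 1) : ℂ)) →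
        z k ∈ Δset → (z 0).im ≠ 0 →
        ∀ M : ℝ, (∀ w ∈ Dinf, ‖φ w‖ ≤ M) →
          ‖(Tbrj^[k] φ) (z 0) -
              ((pden m k : ℂ) - (qden m k : ℂ) * z 0) *
                (φ (z k) + φ (z k - 1) +
                  (if m k = 1 then (0 : ℂ) else 1) * φ (z k + 1)) +
              ((pden m (k - 1) : ℂ) - (qden m (k - 1) : ℂ) * z 0) * (1 + z (k - 1)) *
                (if k = 1 ∨ m (k - 1) = 1 then (0 : ℂ) else 1) *
                φ (-z (k - 1) / (1 + z (k - 1)))‖ ≤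
            c * k * (((Real.sqrt 5 + 1) / 2)⁻¹) ^ k * M := by
  have hK := twelve_le_stepConst
  have hS := one_le_invSqSum
  have h5 : √5 ^ 2 = 5 := Real.sq_sqrt (by norm_num)
  have h5l : 2 ≤ √5 := Real.le_sqrt_of_sq_le (by norm_num)
  have h5u : √5 ≤ 7 / 3 := Real.sqrt_le_iff.2 (by norm_num)
  refine ⟨320000 * stepConst ^ 3 * invSqSum, by positivity, ?_⟩
  intro k hk m hm φ hφ z hD hrec hΔ him M hM
  set G : ℝ := (√5 + 1) / 2 with hGdef
  have hG : 1 ≤ G := by linarith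
  have hG' : G ≤ 5 / 3 := by linarith
  have hG2 : G ^ 2 = G + 1 := by rw [hGdef]; linear_combination h5 / 4
  have hM0 := nonneg_of_forall_mem_Dinf hM
  have hγ : 3 / 5 ≤ G⁻¹ := by
    rw [le_inv_comm₀ (by norm_num) (by positivity)]
    linarith
  set A : ℝ := 16000 * invSqSum * M with hAdef
  have hA : 0 ≤ A := by positivity
  have hMA : M ≤ A := by nlinarith
  have hL : ∀ j, LeftBound (Tbrj^[j] φ) (A * G⁻¹ ^ j) := fun j =>
    ((leftBound_of_forall_mem_Dinf hφ hM).iterate_Tbrj j).mono <| by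
      calc _ = A * (3 / 5) ^ j := by rw [hAdef]; ring
        _ ≤ _ := by gcongr
  have hL0 : LeftBound φ A := by simpa using hL 0
  have hφA : ∀ w ∈ Dinf, ‖φ w‖ ≤ A := fun w hw => (hM w hw).trans hMA
  have hK13 : stepConst ≤ stepConst ^ 3 := le_self_pow₀ (by linarith) (by norm_num)
  have hK23 : stepConst ^ 2 ≤ stepConst ^ 3 := pow_le_pow_right₀ (by linarith) (by norm_num)
  obtain _ | _ | n := k
  · omega
  · have h1 := norm_convergentGap_mul_Tbrj_add_le (k := 0) hm hG (by linarith) hG2 hL0 hφA hD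
      hrec hΔ him
    rw [convergentGap_zero, one_mul] at h1
    simp only [zero_add, Function.iterate_one, true_or, if_true, mul_zero, zero_mul, add_zero,
      Nat.cast_one, mul_one] at h1 ⊢
    refine h1.trans ?_
    calc _ ≤ 20 * stepConst ^ 3 * A * G⁻¹ ^ 1 := by gcongr; norm_num
      _ = _ := by rw [hAdef]; ring
  · have h1 := norm_convergentGap_mul_Tbrj_add_le (k := n + 1) hm hG (by linarith) hG2 hL0 hφA
      hD hrec hΔ him
    have h2 := norm_convergentGap_mul_Tbrj_Tbrj_add_le hm hG (by linarith) hG2 hL0 hD hrec him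
    have h3 := norm_iterate_Tbrj_sub_le hm hG (by linarith) hG2 hL hD hrec him n 0 rfl
    rw [zero_add, Function.iterate_succ_apply' _ 1, Function.iterate_one] at h3
    simp only [Nat.add_sub_cancel, show ¬ n + 1 + 1 = 1 by omega, false_or]
    rw [← convergentGap, ← convergentGap]
    calc _ = ‖_ + _ + _‖ := by congr 1; ring
      _ ≤ _ := norm_add₃_le.trans (add_le_add_three h3 h2 h1)
      _ ≤ n * (16 * stepConst ^ 3 * A * G⁻¹ ^ (n + 2)) +
          16 * stepConst ^ 3 * A * G⁻¹ ^ (n + 2) + 4 * stepConst ^ 3 * A * G⁻¹ ^ (n + 2) := by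
        gcongr
      _ = (16 * n + 20) * (stepConst ^ 3 * A * G⁻¹ ^ (n + 2)) := by ring
      _ ≤ (20 * (n + 2)) * (stepConst ^ 3 * A * G⁻¹ ^ (n + 2)) := by
        gcongr
        have : (0 : ℝ) ≤ n := n.cast_nonneg
        linarith
      _ = _ := by rw [hAdef]; push_cast; ring
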